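/- arXiv:2401.14776 — 2 statements merged into one kernel-verified Lean document; each statement's English description precedes it below -/
import Mathlib

section
/- Let (Ω, 𝓕, P) be a probability space, p ∈ (1,2], σ > 0, λ > 0, and let X : Ω → ℝ^d be an integrable random vector with mean g = E[X] satisfying E[‖X − g‖^p] ≤ σ^p. Define clip_λ(y) = min{1, λ/‖y‖}·y (with clip_λ(0) = 0). Then: (i) ‖clip_λ(X) − E[clip_λ(X)]‖ ≤ 2λ almost surely; moreover, if ‖g‖ ≤ λ/2, then (ii) ‖E[clip_λ(X)] − g‖ ≤ 4 σ^p λ^{1−p}, and (iii) E[‖clip_λ(X) − E[clip_λ(X)]‖²] ≤ 16 σ^p λ^{2−p}. -/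
open MeasureTheory

/-- The clipping operator `clip_λ(y) = min{1, λ/‖y‖}·y` (with `clip_λ(0) = 0`). -/
noncomputable def clip {d : ℕ} (lam : ℝ) (y : EuclideanSpace ℝ (Fin d)) :
    EuclideanSpace ℝ (Fin d) :=
  min 1 (lam / ‖y‖) • y

/-- Clipping maps into the closed ball of radius `lam`. -/
lemma norm_clip_le {d : ℕ} {lam : ℝ} (hlam : 0 ≤ lam) (y : EuclideanSpace ℝ (Fin d)) :
    ‖clip lam y‖ ≤ lam := by
  rcases eq_or_ne y 0 with rfl | hy
  · simpa [clip] using hlam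
  have hy' : 0 < ‖y‖ := norm_pos_iff.2 hy
  rw [clip, norm_smul, Real.norm_of_nonneg (by positivity)]
  calc min 1 (lam / ‖y‖) * ‖y‖ ≤ lam / ‖y‖ * ‖y‖ := by gcongr; exact min_le_right _ _
    _ = lam := div_mul_cancel₀ _ hy'.ne'

lemma clip_of_norm_le {d : ℕ} {lam : ℝ} {y : EuclideanSpace ℝ (Fin d)} (h : ‖y‖ ≤ lam) :
    clip lam y = y := by
  rcases eq_or_ne y 0 with rfl | hy
  · simp [clip]
  rw [clip, min_eq_left ((one_le_div (norm_pos_iff.2 hy)).2 h), one_smul]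

/-- Clipping moves a point by its distance to the ball. -/
lemma norm_clip_sub_self {d : ℕ} {lam : ℝ} {y : EuclideanSpace ℝ (Fin d)} (hlam : 0 < lam)
    (h : lam ≤ ‖y‖) : ‖clip lam y - y‖ = ‖y‖ - lam := by
  have hy : 0 < ‖y‖ := hlam.trans_le h
  have h1 : lam / ‖y‖ ≤ 1 := (div_le_one hy).2 h
  have h2 : clip lam y - y = (lam / ‖y‖ - 1) • y := by
    rw [clip, min_eq_right h1, sub_smul, one_smul]
  rw [h2, norm_smul, Real.norm_of_nonpos (by linarith)]
  field_simp
  ring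

lemma measurable_clip {d : ℕ} (lam : ℝ) :
    Measurable (clip lam : EuclideanSpace ℝ (Fin d) → EuclideanSpace ℝ (Fin d)) := by
  unfold clip
  fun_prop

/-- Pointwise bias bound for clipping, with respect to a centre well inside the ball. -/
lemma norm_clip_sub_self_le {d : ℕ} {p lam : ℝ} (hp : p ∈ Set.Ioc (1 : ℝ) 2) (hlam : 0 < lam)
    {g : EuclideanSpace ℝ (Fin d)} (hg : ‖g‖ ≤ lam / 2) (y : EuclideanSpace ℝ (Fin d)) :
    ‖clip lam y - y‖ ≤ ‖y - g‖ ^ p * lam ^ (1 - p) := by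
  rcases le_total ‖y‖ lam with h | h
  · rw [clip_of_norm_le h, sub_self, norm_zero]
    positivity
  rw [norm_clip_sub_self hlam h]
  have htri : ‖y‖ ≤ ‖y - g‖ + ‖g‖ := by simpa using norm_add_le (y - g) g
  obtain ⟨t, ht⟩ : ∃ t, t = ‖y - g‖ / lam := ⟨_, rfl⟩
  have hr : ‖y - g‖ = t * lam := by rw [ht, div_mul_cancel₀ _ hlam.ne']
  have ht0 : 0 < t := by
    rw [ht]
    exact div_pos (by linarith) hlam
  have hkey : t - 1 / 2 ≤ t ^ p := by
    rcases le_total t 1 with h1 | h1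
    · have := Real.rpow_le_rpow_of_exponent_ge ht0 h1 hp.2
      rw [Real.rpow_two] at this
      nlinarith [sq_nonneg (t - 1 / 2)]
    · have := Real.rpow_le_rpow_of_exponent_le h1 hp.1.le
      rw [Real.rpow_one] at this
      linarith
  have hscale : ‖y - g‖ ^ p * lam ^ (1 - p) = t ^ p * lam := by
    rw [hr, Real.mul_rpow ht0.le hlam.le, mul_assoc, ← Real.rpow_add hlam]
    simp
  rw [hscale]
  nlinarith

/-- Pointwise second-moment bound for clipping, with respect to a centre well inside the ball. -/
lemma norm_clip_sub_sq_le {d : ℕ} {p lam : ℝ} (hp : p ∈ Set.Ioc (1 : ℝ) 2) (hlam : 0 < lam)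
    {g : EuclideanSpace ℝ (Fin d)} (hg : ‖g‖ ≤ lam / 2) (y : EuclideanSpace ℝ (Fin d)) :
    ‖clip lam y - g‖ ^ 2 ≤ 9 * (‖y - g‖ ^ p * lam ^ (2 - p)) := by
  have hball : ‖clip lam y - g‖ ≤ 3 / 2 * lam := by
    linarith [norm_sub_le (clip lam y) g, norm_clip_le hlam.le y]
  have hlin : ‖clip lam y - g‖ ≤ 3 * ‖y - g‖ := by
    rcases le_total ‖y‖ lam with h | h
    · rw [clip_of_norm_le h]
      linarith [norm_nonneg (y - g)]
    · have htri : ‖y‖ ≤ ‖y - g‖ + ‖g‖ := by simpa using norm_add_le (y - g) g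
      linarith
  obtain ⟨t, ht⟩ : ∃ t, t = ‖y - g‖ / lam := ⟨_, rfl⟩
  have hr : ‖y - g‖ = t * lam := by rw [ht, div_mul_cancel₀ _ hlam.ne']
  have ht0 : 0 ≤ t := by
    rw [ht]
    positivity
  have hscale : ‖y - g‖ ^ p * lam ^ (2 - p) = t ^ p * lam ^ 2 := by
    rw [hr, Real.mul_rpow ht0 hlam.le, mul_assoc, ← Real.rpow_add hlam]
    simp
  rw [hscale]
  rcases le_total t 1 with h1 | h1
  · have htp : t ^ 2 ≤ t ^ p := by
      have := Real.rpow_le_rpow_of_exponent_ge' ht0 h1 (by linarith [hp.1]) hp.2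
      rwa [Real.rpow_two] at this
    calc ‖clip lam y - g‖ ^ 2 ≤ (3 * ‖y - g‖) ^ 2 := by gcongr
      _ = 9 * (t ^ 2 * lam ^ 2) := by rw [hr]; ring
      _ ≤ 9 * (t ^ p * lam ^ 2) := by gcongr
  · have htp : 1 ≤ t ^ p := Real.one_le_rpow h1 (by linarith [hp.1])
    calc ‖clip lam y - g‖ ^ 2 ≤ (3 / 2 * lam) ^ 2 := by gcongr
      _ ≤ 9 * (1 * lam ^ 2) := by nlinarith [sq_nonneg lam]
      _ ≤ 9 * (t ^ p * lam ^ 2) := by gcongr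

/-- The mean minimizes the expected squared distance. -/
lemma integral_norm_sub_integral_sq_le {Ω E : Type*} [MeasurableSpace Ω] {μ : Measure Ω}
    [IsProbabilityMeasure μ] [NormedAddCommGroup E] [InnerProductSpace ℝ E] [CompleteSpace E]
    {Y : Ω → E} (hY : MemLp Y 2 μ) (c : E) :
    ∫ ω, ‖Y ω - ∫ ω', Y ω' ∂μ‖ ^ 2 ∂μ ≤ ∫ ω, ‖Y ω - c‖ ^ 2 ∂μ := by
  set m := ∫ ω', Y ω' ∂μ with hm
  have hYi : Integrable Y μ := hY.integrable one_le_two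
  have hsq : Integrable (fun ω => ‖Y ω - m‖ ^ 2) μ :=
    (hY.sub (memLp_const m)).integrable_norm_pow two_ne_zero
  have hcent : Integrable (fun ω => Y ω - m) μ := hYi.sub (integrable_const m)
  have hinner : Integrable (fun ω => 2 * inner ℝ (m - c) (Y ω - m)) μ :=
    (hcent.const_inner (m - c)).const_mul 2
  have hzero : ∫ ω, 2 * inner ℝ (m - c) (Y ω - m) ∂μ = 0 := by
    rw [integral_const_mul, integral_inner hcent, integral_sub hYi (integrable_const m)]
    simp [← hm]
  have hexpand : ∀ ω, ‖Y ω - c‖ ^ 2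
      = ‖Y ω - m‖ ^ 2 + 2 * inner ℝ (m - c) (Y ω - m) + ‖m - c‖ ^ 2 := by
    intro ω
    rw [← sub_add_sub_cancel (Y ω) m c, norm_add_sq_real, real_inner_comm]
  have hsum : Integrable (fun ω => ‖Y ω - m‖ ^ 2 + 2 * inner ℝ (m - c) (Y ω - m)) μ :=
    hsq.add hinner
  simp_rw [hexpand]
  rw [integral_add hsum (integrable_const _), integral_add hsq hinner, hzero]
  simp

/-- Properties of the clipped estimator under heavy-tailed noise: if
`E[‖X - g‖^p] ≤ σ^p` with `g = E[X]`, then (i) the centered clipped estimator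
is a.s. bounded by `2λ`; moreover, if `‖g‖ ≤ λ/2`, then (ii) its bias is at
most `4σ^p λ^{1-p}` and (iii) its second moment is at most `16σ^p λ^{2-p}`. -/
theorem clipped_estimator_bounds {d : ℕ} {Ω : Type*} [MeasurableSpace Ω]
    (μ : Measure Ω) [IsProbabilityMeasure μ]
    (p σ lam : ℝ) (hp : p ∈ Set.Ioc (1:ℝ) 2) (hσ : 0 < σ) (hlam : 0 < lam)
    (X : Ω → EuclideanSpace ℝ (Fin d)) (hX : Integrable X μ)
    (g : EuclideanSpace ℝ (Fin d)) (hg : g = ∫ ω, X ω ∂μ)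
    (hmom_int : Integrable (fun ω => ‖X ω - g‖ ^ p) μ)
    (hmom : ∫ ω, ‖X ω - g‖ ^ p ∂μ ≤ σ ^ p) :
    (∀ᵐ ω ∂μ, ‖clip lam (X ω) - ∫ ω', clip lam (X ω') ∂μ‖ ≤ 2 * lam) ∧
    (‖g‖ ≤ lam / 2 →
      ‖(∫ ω, clip lam (X ω) ∂μ) - g‖ ≤ 4 * σ ^ p * lam ^ (1 - p) ∧
      ∫ ω, ‖clip lam (X ω) - ∫ ω', clip lam (X ω') ∂μ‖^2 ∂μ
        ≤ 16 * σ ^ p * lam ^ (2 - p)) := by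
  have hmeas : AEStronglyMeasurable (fun ω => clip lam (X ω)) μ :=
    ((measurable_clip lam).comp_aemeasurable hX.aemeasurable).aestronglyMeasurable
  have hbound : ∀ᵐ ω ∂μ, ‖clip lam (X ω)‖ ≤ lam := ae_of_all _ fun ω => norm_clip_le hlam.le _
  have hclip : MemLp (fun ω => clip lam (X ω)) 2 μ := MemLp.of_bound hmeas lam hbound
  have hclip_int : Integrable (fun ω => clip lam (X ω)) μ := hclip.integrable one_le_two
  have hσp : 0 ≤ σ ^ p := by positivity
  refine ⟨?_, fun hgl => ⟨?_, ?_⟩⟩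
  · have hmean : ‖∫ ω, clip lam (X ω) ∂μ‖ ≤ lam := by
      simpa using norm_integral_le_of_norm_le_const hbound
    filter_upwards [hbound] with ω hω
    linarith [norm_sub_le (clip lam (X ω)) (∫ ω', clip lam (X ω') ∂μ)]
  · have hl : 0 ≤ lam ^ (1 - p) := by positivity
    calc ‖(∫ ω, clip lam (X ω) ∂μ) - g‖
        = ‖∫ ω, (clip lam (X ω) - X ω) ∂μ‖ := by rw [integral_sub hclip_int hX, ← hg]
      _ ≤ ∫ ω, ‖X ω - g‖ ^ p * lam ^ (1 - p) ∂μ :=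
          norm_integral_le_of_norm_le (hmom_int.mul_const _)
            (ae_of_all _ fun ω => norm_clip_sub_self_le hp hlam hgl (X ω))
      _ = (∫ ω, ‖X ω - g‖ ^ p ∂μ) * lam ^ (1 - p) := integral_mul_const _ _
      _ ≤ σ ^ p * lam ^ (1 - p) := by gcongr
      _ ≤ 4 * σ ^ p * lam ^ (1 - p) := by nlinarith [mul_nonneg hσp hl]
  · have hl : 0 ≤ lam ^ (2 - p) := by positivity
    calc ∫ ω, ‖clip lam (X ω) - ∫ ω', clip lam (X ω') ∂μ‖ ^ 2 ∂μ
        ≤ ∫ ω, ‖clip lam (X ω) - g‖ ^ 2 ∂μ := integral_norm_sub_integral_sq_le hclip g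
      _ ≤ ∫ ω, 9 * (‖X ω - g‖ ^ p * lam ^ (2 - p)) ∂μ :=
          integral_mono ((hclip.sub (memLp_const g)).integrable_norm_pow two_ne_zero)
            ((hmom_int.mul_const _).const_mul 9)
            fun ω => norm_clip_sub_sq_le hp hlam hgl (X ω)
      _ = 9 * ((∫ ω, ‖X ω - g‖ ^ p ∂μ) * lam ^ (2 - p)) := by
          rw [integral_const_mul, integral_mul_const]
      _ ≤ 9 * (σ ^ p * lam ^ (2 - p)) := by gcongr
      _ ≤ 16 * σ ^ p * lam ^ (2 - p) := by nlinarith [mul_nonneg hσp hl]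
end

section
/- Let f_1, …, f_N : ℝ^d → ℝ each be B_g-Lipschitz (|f_j(x) − f_j(y)| ≤ B_g ‖x − y‖ for all x, y), let f = Σ_{j=1}^N f_j, let x_1, …, x_N, x* ∈ ℝ^d, and let x̄ = (1/N) Σ_{i=1}^N x_i. Then Σ_{i=1}^N ( f(x_i) − f(x*) ) ≤ N Σ_{i=1}^N ( f_i(x_i) − f_i(x*) ) + 2 N B_g Σ_{i=1}^N ‖x_i − x̄‖. -/
/-- Decomposition of the global-objective regret into local regrets plus a
consensus penalty: if each `f_j` is `B_g`-Lipschitz and `f = ∑_j f_j`, then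
`∑_i (f(x_i) - f(x*)) ≤ N ∑_i (f_i(x_i) - f_i(x*)) + 2 N B_g ∑_i ‖x_i - x̄‖`. -/
theorem regret_decomposition {d N : ℕ} (B_g : ℝ)
    (f : Fin N → EuclideanSpace ℝ (Fin d) → ℝ)
    (hlip : ∀ j, ∀ x y : EuclideanSpace ℝ (Fin d), |f j x - f j y| ≤ B_g * ‖x - y‖)
    (x : Fin N → EuclideanSpace ℝ (Fin d)) (xs : EuclideanSpace ℝ (Fin d))
    (xbar : EuclideanSpace ℝ (Fin d)) (hxbar : xbar = (N:ℝ)⁻¹ • ∑ i, x i) :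
    ∑ i, ((∑ j, f j (x i)) - ∑ j, f j xs)
      ≤ (N:ℝ) * ∑ i, (f i (x i) - f i xs)
        + 2 * (N:ℝ) * B_g * ∑ i, ‖x i - xbar‖ := by
  have key : ∀ i j, f j (x i) - f j xs
      ≤ (f j (x j) - f j xs) + (B_g * ‖x i - xbar‖ + B_g * ‖x j - xbar‖) := by
    intro i j
    have h₁ := (abs_le.mp (hlip j (x i) xbar)).2
    have h₂ := (abs_le.mp (hlip j (x j) xbar)).1
    linarith
  calc ∑ i, ((∑ j, f j (x i)) - ∑ j, f j xs)
      = ∑ i, ∑ j, (f j (x i) - f j xs) := by simp only [Finset.sum_sub_distrib]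
    _ ≤ ∑ i, ∑ j, ((f j (x j) - f j xs)
          + (B_g * ‖x i - xbar‖ + B_g * ‖x j - xbar‖)) :=
        Finset.sum_le_sum fun i _ => Finset.sum_le_sum fun j _ => key i j
    _ = (N:ℝ) * ∑ i, (f i (x i) - f i xs)
          + 2 * (N:ℝ) * B_g * ∑ i, ‖x i - xbar‖ := by
        simp only [Finset.sum_add_distrib, Finset.sum_const, Finset.card_univ,
          Fintype.card_fin, nsmul_eq_mul, ← Finset.mul_sum]
        ring
end
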